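/- arXiv:1511.02199 — 5 statements merged into one kernel-verified Lean document; each statement's English description precedes it below -/
import Mathlib

section
/- For every natural number n, real r > 0, and integer l with 0 ≤ l ≤ n, the PMF of the Chinese restaurant table distribution satisfies CRT(n,r)(l) = Γ(r) · r^l · |s(n,l)| / Γ(n+r), where Γ is the real Gamma function. -/
open MeasureTheory

/-- The Poisson PMF: `Pois(λ)(n) = λ^n e^{-λ} / n!`. -/
noncomputable def poisPMF (lam : ℝ) (n : ℕ) : ℝ :=
  lam ^ n * Real.exp (-lam) / n.factorial

/-- The gamma density with shape `a > 0` and rate `c > 0`: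
`gammaPDF(a,c)(θ) = c^a / Γ(a) * θ^(a-1) * e^{-cθ}` for `θ > 0`, and `0` for `θ ≤ 0`. -/
noncomputable def gammaPDF (a c θ : ℝ) : ℝ :=
  if 0 < θ then c ^ a / Real.Gamma a * θ ^ (a - 1) * Real.exp (-(c * θ)) else 0

/-- The negative binomial PMF: `NB(r,p)(n) = Γ(n+r)/(n! Γ(r)) * p^n (1-p)^r`. -/
noncomputable def nbPMF (r p : ℝ) (n : ℕ) : ℝ :=
  Real.Gamma (n + r) / (n.factorial * Real.Gamma r) * p ^ n * (1 - p) ^ r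

/-- The unsigned Stirling number of the first kind `|s(n,l)|`: the coefficient of `X^l`
in the ascending factorial polynomial `X (X+1) ⋯ (X+n-1)`. -/
noncomputable def stirling1 (n l : ℕ) : ℕ :=
  (ascPochhammer ℕ n).coeff l

/-- The PMF of the Chinese restaurant table distribution `CRT(n,r)`: the distribution of
`l = Σ_{i=1}^n b_i` with independent `b_i ∼ Bernoulli(r/(r+i-1))`, defined by the
convolution recursion over `n`. -/
noncomputable def crtPMF (r : ℝ) : ℕ → ℕ → ℝ
  | 0, l => if l = 0 then 1 else 0
  | n + 1, l =>
      r / (r + n) * (if l = 0 then 0 else crtPMF r n (l - 1))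
        + (1 - r / (r + n)) * crtPMF r n l

/-- The logarithmic distribution PMF: `Log(p)(u) = p^u / (-ln(1-p) u)` for `u ≥ 1`, else `0`. -/
noncomputable def logPMF (p : ℝ) (u : ℕ) : ℝ :=
  if u = 0 then 0 else p ^ u / (-Real.log (1 - p) * u)

/-- The `l`-fold convolution `Log(p)^{*l}` of the logarithmic distribution, with
`Log(p)^{*0} = δ_0`. -/
noncomputable def logConv (p : ℝ) : ℕ → ℕ → ℝ
  | 0, n => if n = 0 then 1 else 0
  | l + 1, n => ∑ u ∈ Finset.range (n + 1), logPMF p u * logConv p l (n - u)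

theorem stirling1_succ_zero (n : ℕ) : stirling1 (n + 1) 0 = n * stirling1 n 0 := by
  simp [stirling1, ascPochhammer_succ_right, mul_add, mul_comm]

theorem stirling1_succ_succ (n l : ℕ) :
    stirling1 (n + 1) (l + 1) = stirling1 n l + n * stirling1 n (l + 1) := by
  rw [stirling1, ascPochhammer_succ_right, mul_add, Polynomial.coeff_add,
    Polynomial.coeff_mul_X, Polynomial.coeff_mul_natCast, mul_comm]
  rfl

/-- The closed form of the CRT PMF holds for every `l`; both sides vanish for `l > n`. -/
theorem crtPMF_eq_of_pos {r : ℝ} (hr : 0 < r) (n l : ℕ) :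
    crtPMF r n l = Real.Gamma r * r ^ l * (stirling1 n l : ℝ) / Real.Gamma (n + r) := by
  induction n generalizing l with
  | zero =>
    have hG := (Real.Gamma_pos_of_pos hr).ne'
    by_cases hl : l = 0 <;> simp [crtPMF, stirling1, Polynomial.coeff_one, hl, hG]
  | succ n ih =>
    have hpos : (0 : ℝ) < n + r := by positivity
    have hne : r + n ≠ 0 := by linarith
    have hG := (Real.Gamma_pos_of_pos hpos).ne'
    have hGamma : Real.Gamma ((n + 1 : ℕ) + r) = (r + n) * Real.Gamma (n + r) := by
      rw [add_comm r, ← Real.Gamma_add_one hpos.ne']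
      push_cast
      ring_nf
    rw [hGamma]
    cases l with
    | zero =>
      simp only [crtPMF, ih, stirling1_succ_zero, if_true]
      push_cast
      field_simp
      ring
    | succ l =>
      simp only [crtPMF, ih, stirling1_succ_succ, Nat.add_one_ne_zero, if_false,
        Nat.add_sub_cancel]
      push_cast
      field_simp
      ring

/-- For every `n : ℕ`, `r > 0`, and `0 ≤ l ≤ n`, the CRT PMF satisfies
`CRT(n,r)(l) = Γ(r) r^l |s(n,l)| / Γ(n+r)`. -/
theorem crtPMF_eq (n : ℕ) (r : ℝ) (hr : 0 < r) (l : ℕ) (hl : l ≤ n) :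
    crtPMF r n l = Real.Gamma r * r ^ l * (stirling1 n l : ℝ) / Real.Gamma (n + r) := by
  exact crtPMF_eq_of_pos hr n l
end

section
/- (Compound Poisson representation of the negative binomial.) For every r > 0, p ∈ (0,1), and n ∈ ℕ, summing a Poisson(−r ln(1−p)) number of i.i.d. logarithmic random variables yields a negative binomial: Σ_{l=0}^∞ Pois(−r ln(1−p))(l) · Log(p)^{*l}(n) = NB(r,p)(n). -/
open MeasureTheory

/-- The generating function of the logarithmic distribution. -/
noncomputable def logPowerSeries (p : ℝ) : PowerSeries ℝ := PowerSeries.mk (logPMF p)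

theorem logConv_eq_coeff_pow (p : ℝ) (l n : ℕ) :
    logConv p l n = PowerSeries.coeff n (logPowerSeries p ^ l) := by
  induction l generalizing n with
  | zero => simp [logConv, PowerSeries.coeff_one]
  | succ l ih =>
    rw [pow_succ', PowerSeries.coeff_mul, logConv,
      Finset.Nat.sum_antidiagonal_eq_sum_range_succ_mk]
    simp [ih, logPowerSeries]

theorem logConv_eq_zero_of_lt (p : ℝ) {l n : ℕ} (h : n < l) : logConv p l n = 0 := by
  rw [logConv_eq_coeff_pow]
  have hX : PowerSeries.X ∣ logPowerSeries p := by
    rw [PowerSeries.X_dvd_iff]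
    simp [logPowerSeries, logPMF]
  exact PowerSeries.X_pow_dvd_iff.mp (pow_dvd_pow_of_dvd hX l) n h

theorem derivative_logPowerSeries (p : ℝ) :
    (1 - PowerSeries.C p * PowerSeries.X) * PowerSeries.derivative ℝ (logPowerSeries p) =
      PowerSeries.C (p / -Real.log (1 - p)) := by
  have hcoeff (n : ℕ) : PowerSeries.coeff n (PowerSeries.derivative ℝ (logPowerSeries p)) =
      p ^ (n + 1) / -Real.log (1 - p) := by
    have : (n : ℝ) + 1 ≠ 0 := by positivity
    simp only [PowerSeries.coeff_derivative, logPowerSeries, PowerSeries.coeff_mk, logPMF,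
      Nat.add_eq_zero_iff, one_ne_zero, and_false, if_false, Nat.cast_add, Nat.cast_one]
    rw [← div_div, div_mul_cancel₀ _ this]
  ext n
  rw [sub_mul, one_mul, mul_assoc, map_sub, PowerSeries.coeff_C_mul, PowerSeries.coeff_C, hcoeff]
  cases n with
  | zero => simp
  | succ n =>
    rw [PowerSeries.coeff_succ_X_mul, hcoeff, if_neg n.succ_ne_zero]
    ring

theorem succ_mul_logConv_succ (p : ℝ) (l n : ℕ) :
    (n + 1) * logConv p (l + 1) (n + 1) =
      p * n * logConv p (l + 1) n + (l + 1) * (p / -Real.log (1 - p)) * logConv p l n := by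
  have key : (1 - PowerSeries.C p * PowerSeries.X) *
      PowerSeries.derivative ℝ (logPowerSeries p ^ (l + 1)) =
      PowerSeries.C ((l + 1) * (p / -Real.log (1 - p))) * logPowerSeries p ^ l := by
    rw [Derivation.leibniz_pow, map_mul, ← derivative_logPowerSeries]
    simp only [add_tsub_cancel_right, smul_eq_mul, nsmul_eq_mul, Nat.cast_add, Nat.cast_one,
      map_add, map_natCast, map_one]
    ring
  have h := congrArg (PowerSeries.coeff n) key
  rw [sub_mul, one_mul, mul_assoc, map_sub, PowerSeries.coeff_C_mul, PowerSeries.coeff_C_mul,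
    PowerSeries.coeff_derivative, ← logConv_eq_coeff_pow, ← logConv_eq_coeff_pow] at h
  have hX : PowerSeries.coeff n
      (PowerSeries.X * PowerSeries.derivative ℝ (logPowerSeries p ^ (l + 1))) =
      n * logConv p (l + 1) n := by
    cases n with
    | zero => simp
    | succ n =>
      rw [PowerSeries.coeff_succ_X_mul, PowerSeries.coeff_derivative, ← logConv_eq_coeff_pow]
      push_cast
      ring
  rw [hX] at h
  linarith

theorem sum_pow_div_factorial_mul_logConv {r p : ℝ} (hr : 0 < r) (hlog : Real.log (1 - p) ≠ 0)
    {n N : ℕ} (hN : n < N) :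
    ∑ l ∈ Finset.range N, (-r * Real.log (1 - p)) ^ l / l.factorial * logConv p l n =
      Real.Gamma (n + r) / (n.factorial * Real.Gamma r) * p ^ n := by
  induction n generalizing N with
  | zero =>
    rw [Finset.sum_eq_single_of_mem 0 (by simpa using hN)]
    · simp [logConv, (Real.Gamma_pos_of_pos hr).ne']
    · intro l _ hl
      rw [logConv_eq_zero_of_lt p (Nat.pos_of_ne_zero hl), mul_zero]
  | succ n ih =>
    obtain ⟨M, rfl⟩ : ∃ M, N = M + 1 := ⟨N - 1, by omega⟩
    have hstep (l : ℕ) :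
        (n + 1) * ((-r * Real.log (1 - p)) ^ (l + 1) / (l + 1).factorial *
          logConv p (l + 1) (n + 1)) =
        p * n * ((-r * Real.log (1 - p)) ^ (l + 1) / (l + 1).factorial * logConv p (l + 1) n) +
          r * p * ((-r * Real.log (1 - p)) ^ l / l.factorial * logConv p l n) := by
      rw [mul_left_comm, succ_mul_logConv_succ, Nat.factorial_succ]
      have hl : (l : ℝ) + 1 ≠ 0 := by positivity
      push_cast
      field_simp
      ring
    have hzero : (n : ℝ) * logConv p 0 n = 0 := by
      cases n <;> simp [logConv]
    have hfull := ih (N := M + 1) (by omega)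
    have hinit := ih (N := M) (by omega)
    rw [Finset.sum_range_succ'] at hfull ⊢
    have hn : (n : ℝ) + 1 ≠ 0 := by positivity
    apply mul_left_cancel₀ hn
    have hsum : (n + 1) * ∑ l ∈ Finset.range M, (-r * Real.log (1 - p)) ^ (l + 1) /
          (l + 1).factorial * logConv p (l + 1) (n + 1) =
        p * (n + r) * (Real.Gamma (n + r) / (n.factorial * Real.Gamma r) * p ^ n) := by
      rw [Finset.mul_sum, Finset.sum_congr rfl fun l _ ↦ hstep l, Finset.sum_add_distrib,
        ← Finset.mul_sum, ← Finset.mul_sum, hinit]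
      simp only [pow_zero, Nat.factorial_zero, Nat.cast_one, div_one, one_mul] at hfull
      linear_combination p * n * hfull - p * hzero
    have hGamma : Real.Gamma ((n + 1 : ℕ) + r) = (n + r) * Real.Gamma (n + r) := by
      rw [← Real.Gamma_add_one (by positivity)]
      push_cast
      ring_nf
    have hGr := (Real.Gamma_pos_of_pos hr).ne'
    rw [mul_add, hsum, hGamma, Nat.factorial_succ]
    simp only [logConv, n.succ_ne_zero, if_false, mul_zero, add_zero]
    push_cast
    field_simp
    ring

/-- (Compound Poisson representation of the negative binomial.)  For `r > 0`,
`p ∈ (0,1)`, and `n : ℕ`, summing a `Pois(-r ln(1-p))` number of i.i.d. `Log(p)` variables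
yields `NB(r,p)`:  `Σ_{l=0}^∞ Pois(-r ln(1-p))(l) ⋅ Log(p)^{*l}(n) = NB(r,p)(n)`. -/
theorem compound_poisson_eq_nb (r p : ℝ) (hr : 0 < r) (hp0 : 0 < p) (hp1 : p < 1) (n : ℕ) :
    ∑' l : ℕ, poisPMF (-r * Real.log (1 - p)) l * logConv p l n = nbPMF r p n := by
  have hlog : Real.log (1 - p) < 0 := Real.log_neg (by linarith) (by linarith)
  have hsupp : ∀ l ∉ Finset.range (n + 1),
      poisPMF (-r * Real.log (1 - p)) l * logConv p l n = 0 := by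
    intro l hl
    rw [logConv_eq_zero_of_lt p (by simpa using hl), mul_zero]
  have hexp : Real.exp (-(-r * Real.log (1 - p))) = (1 - p) ^ r := by
    rw [Real.rpow_def_of_pos (by linarith)]
    ring_nf
  rw [tsum_eq_sum hsupp, nbPMF, ← sum_pow_div_factorial_mul_logConv hr hlog.ne n.lt_succ_self,
    Finset.sum_mul]
  refine Finset.sum_congr rfl fun l _ ↦ ?_
  rw [poisPMF, hexp]
  ring
end

section
/- (Poisson-logarithmic bivariate PMF, CRT–negative-binomial side.) For every r > 0, p ∈ (0,1), n ∈ ℕ, and 0 ≤ l ≤ n, the joint PMF of n ∼ NB(r,p) and l | n ∼ CRT(n,r) is NB(r,p)(n) · CRT(n,r)(l) = |s(n,l)| · r^l · p^n · (1−p)^r / n!. -/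
open MeasureTheory

/-- The recursion `|s(n+1,l)| = |s(n,l-1)| + n |s(n,l)|`. -/
theorem stirling1_succ (n l : ℕ) :
    stirling1 (n + 1) l = (if l = 0 then 0 else stirling1 n (l - 1)) + n * stirling1 n l := by
  unfold stirling1
  rw [ascPochhammer_succ_right, mul_add, Polynomial.coeff_add, Polynomial.coeff_mul_natCast]
  cases l with
  | zero => simp [mul_comm]
  | succ l => simp [Polynomial.coeff_mul_X, mul_comm]

/-- The CRT PMF in closed form: `CRT(n,r)(l) = Γ(r)/Γ(n+r) |s(n,l)| r^l`, cleared of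
denominators. -/
theorem Gamma_mul_crtPMF {r : ℝ} (hr : 0 < r) (n l : ℕ) :
    Real.Gamma (n + r) * crtPMF r n l = Real.Gamma r * stirling1 n l * r ^ l := by
  induction n generalizing l with
  | zero =>
    rcases Nat.eq_zero_or_pos l with rfl | h
    · simp [crtPMF, stirling1]
    · simp [crtPMF, stirling1, Polynomial.coeff_one, h.ne']
  | succ n ih =>
    have hpos : 0 < r + n := by positivity
    have hG : Real.Gamma (((n + 1 : ℕ) : ℝ) + r) = (r + n) * Real.Gamma (n + r) := by
      rw [add_comm r, ← Real.Gamma_add_one (by linarith)]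
      push_cast
      ring_nf
    have hrec : (r + n) * crtPMF r (n + 1) l =
        r * (if l = 0 then 0 else crtPMF r n (l - 1)) + n * crtPMF r n l := by
      rw [crtPMF]
      field_simp
      ring
    rw [hG, mul_right_comm, hrec, stirling1_succ]
    cases l with
    | zero =>
      have h := ih 0
      simp only [if_true]
      push_cast
      linear_combination n * h
    | succ l =>
      have h₀ := ih l
      have h₁ := ih (l + 1)
      simp only [Nat.add_eq_zero_iff, one_ne_zero, and_false, if_false, Nat.add_sub_cancel]
      push_cast
      linear_combination r * h₀ + n * h₁

/-- (Poisson-logarithmic bivariate PMF, CRT–negative-binomial side.)  For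
`r > 0`, `p ∈ (0,1)`, `n : ℕ`, and `0 ≤ l ≤ n`, the joint PMF of `n ∼ NB(r,p)` and
`l | n ∼ CRT(n,r)` is `NB(r,p)(n) ⋅ CRT(n,r)(l) = |s(n,l)| r^l p^n (1-p)^r / n!`. -/
theorem nb_crt_joint (r p : ℝ) (hr : 0 < r) (hp0 : 0 < p) (hp1 : p < 1)
    (n l : ℕ) (hl : l ≤ n) :
    nbPMF r p n * crtPMF r n l
      = (stirling1 n l : ℝ) * r ^ l * p ^ n * (1 - p) ^ r / n.factorial := by
  have hΓ : Real.Gamma r ≠ 0 := (Real.Gamma_pos_of_pos hr).ne'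
  calc
    nbPMF r p n * crtPMF r n l
        = Real.Gamma (n + r) * crtPMF r n l * p ^ n * (1 - p) ^ r
            / (n.factorial * Real.Gamma r) := by
          unfold nbPMF
          ring
    _ = _ := by
          rw [Gamma_mul_crtPMF hr]
          field_simp
end

section
/- (Moments of the PGBN gamma chain.) Fix r > 0 and define probability measures on (0,∞) by μ_1 = Gamma(r, 1) and μ_{k+1}(A) = ∫₀^∞ Gamma(θ, 1)(A) dμ_k(θ) for k ≥ 1. Then for every k ≥ 1 the mean of μ_k equals r and the variance of μ_k equals k·r. In particular, in a PGBN with T hidden layers, identity connection weight matrices Φ^{(t)} = I for t ≥ 2, and all gamma scales equal to 1, the layer-two hidden unit θ^{(2)} given top-layer shape r satisfies E[θ^{(2)} | r] = r and Var[θ^{(2)} | r] = (T−1)·r. -/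
open MeasureTheory

open ProbabilityTheory

lemma gammaMeasure_Iic_zero (a c : ℝ) : gammaMeasure a c (Set.Iic 0) = 0 := by
  rw [gammaMeasure, withDensity_apply _ measurableSet_Iic, setLIntegral_congr Iio_ae_eq_Iic.symm]
  exact lintegral_gammaPDF_of_nonpos le_rfl

lemma lintegral_pow_gammaMeasure {a c : ℝ} (ha : 0 < a) (hc : 0 < c) (n : ℕ) :
    ∫⁻ x, ENNReal.ofReal (x ^ n) ∂(gammaMeasure a c) =
      ENNReal.ofReal (Real.Gamma (a + n) / (Real.Gamma a * c ^ n)) := by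
  have han : 0 < a + n := by positivity
  have hpdf (b : ℝ) : Measurable (ProbabilityTheory.gammaPDF b c) :=
    (measurable_gammaPDFReal b c).ennreal_ofReal
  have hshift : (ProbabilityTheory.gammaPDF a c * fun x => ENNReal.ofReal (x ^ n)) =ᵐ[volume]
      fun x => ENNReal.ofReal (Real.Gamma (a + n) / (Real.Gamma a * c ^ n)) *
        ProbabilityTheory.gammaPDF (a + n) c x := by
    filter_upwards [Measure.ae_ne volume (0 : ℝ)] with x hx
    rcases hx.lt_or_gt with hx | hx
    · simp [gammaPDF_of_neg hx]
    · have hΓ := Real.Gamma_pos_of_pos ha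
      have hΓn := Real.Gamma_pos_of_pos han
      rw [Pi.mul_apply, gammaPDF_of_nonneg hx.le, gammaPDF_of_nonneg hx.le,
        ← ENNReal.ofReal_mul (by positivity), ← ENNReal.ofReal_mul (by positivity),
        show a + n - 1 = (a - 1) + n by ring, Real.rpow_add hx, Real.rpow_add hc,
        Real.rpow_natCast, Real.rpow_natCast]
      congr 1
      field_simp
  rw [gammaMeasure, lintegral_withDensity_eq_lintegral_mul _ (hpdf a) (by fun_prop),
    lintegral_congr_ae hshift, lintegral_const_mul _ (hpdf _), lintegral_gammaPDF_eq_one han hc,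
    mul_one]

lemma aemeasurable_gammaMeasure {ν : Measure ℝ} (hν : ν (Set.Iic 0) = 0) (c : ℝ) :
    AEMeasurable (fun θ => gammaMeasure θ c) ν := by
  have hΓ : Measurable ((Set.Ioi (0 : ℝ)).piecewise Real.Gamma 0) :=
    ContinuousOn.measurable_piecewise Real.differentiableOn_Gamma_Ioi.continuousOn
      continuousOn_const measurableSet_Ioi
  let g (θ x : ℝ) : ENNReal := ENNReal.ofReal (if 0 ≤ x then
    c ^ θ / (Set.Ioi (0 : ℝ)).piecewise Real.Gamma 0 θ * x ^ (θ - 1) * Real.exp (-(c * x)) else 0)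
  have hg : Measurable (Function.uncurry g) := by
    refine (Measurable.ite (measurableSet_le measurable_const measurable_snd) ?_
      measurable_const).ennreal_ofReal
    have : Measurable fun p : ℝ × ℝ => (Set.Ioi (0 : ℝ)).piecewise Real.Gamma 0 p.1 :=
      hΓ.comp measurable_fst
    fun_prop
  refine ⟨fun θ => volume.withDensity (g θ), Measure.measurable_of_measurable_coe _ fun s hs => ?_,
    ?_⟩
  · simp_rw [withDensity_apply _ hs]
    exact hg.lintegral_prod_right'
  · have hpos : ∀ᵐ θ ∂ν, 0 < θ := by simpa [ae_iff, Set.Iic] using hν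
    filter_upwards [hpos] with θ hθ
    rw [gammaMeasure]
    congr 1
    ext x
    simp [g, gammaPDF_eq, Set.piecewise, hθ]

/-- The law of the `k`-th element of the gamma chain lives on `(0, ∞)` and has the prescribed
first two moments. -/
lemma gamma_chain_lintegral {r : ℝ} (hr : 0 < r) {μ : ℕ → Measure ℝ}
    (hμ1 : μ 1 = gammaMeasure r 1)
    (hstep : ∀ k, 1 ≤ k → μ (k + 1) = (μ k).bind fun θ => gammaMeasure θ 1)
    {k : ℕ} (hk : 1 ≤ k) :
    μ k (Set.Iic 0) = 0 ∧ ∫⁻ x, ENNReal.ofReal x ∂(μ k) = ENNReal.ofReal r ∧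
      ∫⁻ x, ENNReal.ofReal (x ^ 2) ∂(μ k) = ENNReal.ofReal (r ^ 2 + k * r) := by
  have hmean {θ : ℝ} (hθ : 0 < θ) :
      ∫⁻ x, ENNReal.ofReal x ∂(gammaMeasure θ 1) = ENNReal.ofReal θ := by
    have h := lintegral_pow_gammaMeasure hθ one_pos 1
    simp only [pow_one, Nat.cast_one, mul_one, Real.Gamma_add_one hθ.ne'] at h
    rwa [mul_div_cancel_right₀ _ (Real.Gamma_pos_of_pos hθ).ne'] at h
  have hsq {θ : ℝ} (hθ : 0 < θ) :
      ∫⁻ x, ENNReal.ofReal (x ^ 2) ∂(gammaMeasure θ 1) = ENNReal.ofReal (θ ^ 2 + θ) := by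
    rw [lintegral_pow_gammaMeasure hθ one_pos 2, show θ + (2 : ℕ) = θ + 1 + 1 by push_cast; ring,
      Real.Gamma_add_one (by positivity), Real.Gamma_add_one hθ.ne']
    have := (Real.Gamma_pos_of_pos hθ).ne'
    congr 1
    field_simp
  induction k, hk using Nat.le_induction with
  | base =>
    rw [hμ1, hmean hr, hsq hr]
    exact ⟨gammaMeasure_Iic_zero r 1, rfl, by simp⟩
  | succ k hk ih =>
    obtain ⟨h0, h1, h2⟩ := ih
    have hpos : ∀ᵐ θ ∂(μ k), 0 < θ := by simpa [ae_iff, Set.Iic] using h0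
    have hm := aemeasurable_gammaMeasure h0 1
    rw [hstep k hk]
    refine ⟨?_, ?_, ?_⟩
    · simp [Measure.bind_apply measurableSet_Iic hm, gammaMeasure_Iic_zero]
    · rw [Measure.lintegral_bind hm (by fun_prop), ← h1]
      exact lintegral_congr_ae (hpos.mono fun θ hθ => hmean hθ)
    · rw [Measure.lintegral_bind hm (by fun_prop),
        lintegral_congr_ae (hpos.mono fun θ hθ => (hsq hθ).trans
          (ENNReal.ofReal_add (sq_nonneg θ) hθ.le)),
        lintegral_add_left (by fun_prop), h1, h2, ← ENNReal.ofReal_add (by positivity) hr.le]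
      congr 1
      push_cast
      ring

/-- (Moments of the PGBN gamma chain.)  Fix `r > 0` and define `μ_1 =
Gamma(r,1)` and `μ_{k+1}(A) = ∫₀^∞ Gamma(θ,1)(A) dμ_k(θ)`.  Then for every `k ≥ 1` the mean
of `μ_k` is `r` and the variance of `μ_k` is `k ⋅ r`.  In particular, in a PGBN with `T ≥ 2`
hidden layers, identity connection weight matrices and unit gamma scales, the layer-two hidden
unit, whose law is `μ_{T-1}`, has conditional mean `r` and conditional variance `(T-1) r`. -/
theorem gamma_chain_moments (r : ℝ) (hr : 0 < r)
    (μ : ℕ → Measure ℝ) (hμ1 : μ 1 = gammaMeasure r 1)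
    (hstep : ∀ k, 1 ≤ k → μ (k + 1) = (μ k).bind fun θ => gammaMeasure θ 1) :
    (∀ k, 1 ≤ k →
      (∫ x, x ∂(μ k) = r) ∧ (∫ x, x ^ 2 ∂(μ k)) - (∫ x, x ∂(μ k)) ^ 2 = k * r) ∧
    (∀ T : ℕ, 2 ≤ T →
      (∫ x, x ∂(μ (T - 1)) = r) ∧
        (∫ x, x ^ 2 ∂(μ (T - 1))) - (∫ x, x ∂(μ (T - 1))) ^ 2 = ((T : ℝ) - 1) * r) := by
  have key (k : ℕ) (hk : 1 ≤ k) : (∫ x, x ∂(μ k) = r) ∧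
      (∫ x, x ^ 2 ∂(μ k)) - (∫ x, x ∂(μ k)) ^ 2 = k * r := by
    obtain ⟨h0, h1, h2⟩ := gamma_chain_lintegral hr hμ1 hstep hk
    have hpos : ∀ᵐ θ ∂(μ k), 0 < θ := by simpa [ae_iff, Set.Iic] using h0
    have hmean : ∫ x, x ∂(μ k) = r := by
      rw [integral_eq_lintegral_of_nonneg_ae (hpos.mono fun θ hθ => hθ.le) (by fun_prop), h1,
        ENNReal.toReal_ofReal hr.le]
    have hsq : ∫ x, x ^ 2 ∂(μ k) = r ^ 2 + k * r := by
      rw [integral_eq_lintegral_of_nonneg_ae (ae_of_all _ fun θ => sq_nonneg θ) (by fun_prop), h2,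
        ENNReal.toReal_ofReal (by positivity)]
    exact ⟨hmean, by rw [hmean, hsq]; ring⟩
  refine ⟨key, fun T hT => ?_⟩
  have h := key (T - 1) (by lia)
  rwa [Nat.cast_sub (by lia), Nat.cast_one] at h
end

section
/- (Lemma 1, inductive step in vector form.) Let V, K ≥ 1, let φ ∈ [0,∞)^{V×K} satisfy Σ_{v=1}^V φ_{vk} = 1 for every k, let a_1,…,a_K > 0, c > 0, s > 0, and let m ∈ ℕ^K. Then summing over all latent count arrays and integrating out the gamma hidden units gives a product of negative binomials: Σ_{x ∈ ℕ^{V×K} : Σ_v x_{vk} = m_k for all k} ∫_{(0,∞)^K} ∏_{v=1}^V ∏_{k=1}^K Pois(φ_{vk} θ_k s)(x_{vk}) · ∏_{k=1}^K gammaPDF(a_k, c)(θ_k) dθ = ∏_{k=1}^K NB(a_k, s/(c+s))(m_k). In particular, under the PGBN layer model x_{vk} | θ ∼ Pois(φ_{vk} θ_k s) independently with θ_k ∼ Gamma(a_k, 1/c), the column sums m_k = Σ_v x_{vk} are independent with m_k ∼ NB(a_k, s/(c+s)). -/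
open MeasureTheory

/-- Integrating a gamma density against independent Poisson counts whose rates `p v * θ * s` share
the gamma variable `θ` gives a multinomial weight times a negative binomial probability. -/
lemma integral_prod_poisPMF_mul_gammaPDF {V : ℕ} (p : Fin V → ℝ) (hp : ∑ v, p v = 1)
    {a c s : ℝ} (ha : 0 < a) (hc : 0 < c) (hs : 0 < s) (y : Fin V → ℕ) (n : ℕ)
    (hy : ∑ v, y v = n) :
    ∫ θ in Set.Ioi (0 : ℝ), (∏ v, poisPMF (p v * θ * s) (y v)) * gammaPDF a c θ
      = Nat.multinomial Finset.univ y * (∏ v, p v ^ y v) * nbPMF a (s / (c + s)) n := by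
  have hcs : 0 < c + s := by positivity
  have hpois (θ : ℝ) : ∏ v, poisPMF (p v * θ * s) (y v)
      = (∏ v, p v ^ y v) * (θ * s) ^ n * Real.exp (-(θ * s))
        / (∏ v, ((y v).factorial : ℝ)) := by
    simp only [poisPMF, Finset.prod_div_distrib, Finset.prod_mul_distrib, mul_assoc, mul_pow (p _)]
    rw [Finset.prod_pow_eq_pow_sum, hy, ← Real.exp_sum, Finset.sum_neg_distrib,
      ← Finset.sum_mul, hp, one_mul]
  have hint : ∀ θ ∈ Set.Ioi (0 : ℝ), (∏ v, poisPMF (p v * θ * s) (y v)) * gammaPDF a c θ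
      = ((∏ v, p v ^ y v) * s ^ n / (∏ v, ((y v).factorial : ℝ))
        * (c ^ a / Real.Gamma a)) * (θ ^ ((n + a) - 1) * Real.exp (-((c + s) * θ))) := by
    intro θ hθ
    have hθ' : 0 < θ := hθ
    rw [hpois, gammaPDF, if_pos hθ', add_sub_assoc, Real.rpow_add hθ', Real.rpow_natCast,
      show -((c + s) * θ) = -(θ * s) + -(c * θ) by ring, Real.exp_add, mul_pow]
    ring
  rw [setIntegral_congr_fun measurableSet_Ioi hint, integral_const_mul,
    Real.integral_rpow_mul_exp_neg_mul_Ioi (by positivity) hcs]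
  have hmul : (∏ v, ((y v).factorial : ℝ)) * Nat.multinomial Finset.univ y = n.factorial := by
    have := Nat.multinomial_spec Finset.univ y
    rw [hy] at this
    exact_mod_cast this
  have hq : 1 - s / (c + s) = c / (c + s) := by field_simp; ring
  have hM : (Nat.multinomial Finset.univ y : ℝ) = n.factorial / ∏ v, ((y v).factorial : ℝ) := by
    rw [← hmul]; field_simp
  rw [nbPMF, hq, hM, Real.div_rpow zero_le_one hcs.le, Real.one_rpow, Real.rpow_add hcs,
    Real.rpow_natCast, Real.div_rpow hc.le hcs.le, div_pow]
  field_simp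

/-- (Lemma 1, inductive step in vector form.)  Let `V, K ≥ 1`, let
`φ ∈ [0,∞)^{V×K}` have unit-`L₁`-norm columns, let `a_k > 0`, `c > 0`, `s > 0`, and
`m ∈ ℕ^K`.  Summing over all latent count arrays `x` with column sums `m` and integrating out
the gamma hidden units `θ ∈ (0,∞)^K` gives a product of negative binomials:
`Σ_{x : Σ_v x_{vk} = m_k} ∫_{(0,∞)^K} ∏_{v,k} Pois(φ_{vk} θ_k s)(x_{vk})
 ⋅ ∏_k gammaPDF(a_k,c)(θ_k) dθ = ∏_k NB(a_k, s/(c+s))(m_k)`. -/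
theorem pgbn_layer_marginal (V K : ℕ) (hV : 1 ≤ V) (hK : 1 ≤ K)
    (φ : Fin V → Fin K → ℝ) (hφ : ∀ v k, 0 ≤ φ v k)
    (hφsum : ∀ k, ∑ v, φ v k = 1)
    (a : Fin K → ℝ) (ha : ∀ k, 0 < a k) (c s : ℝ) (hc : 0 < c) (hs : 0 < s)
    (m : Fin K → ℕ) :
    ∑' x : Fin V → Fin K → ℕ,
      (if ∀ k, ∑ v, x v k = m k then
        ∫ θ in Set.univ.pi fun _ : Fin K => Set.Ioi (0 : ℝ),
          (∏ v, ∏ k, poisPMF (φ v k * θ k * s) (x v k)) * ∏ k, gammaPDF (a k) c (θ k)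
      else 0)
      = ∏ k, nbPMF (a k) (s / (c + s)) (m k) := by
  rw [← (Equiv.piComm fun (_ : Fin K) (_ : Fin V) => ℕ).tsum_eq,
    tsum_eq_sum (s := Fintype.piFinset fun k => Finset.univ.piAntidiag (m k))]
  · have hterm : ∀ y ∈ Fintype.piFinset fun k => (Finset.univ : Finset (Fin V)).piAntidiag (m k),
        (if ∀ k, ∑ v, (Equiv.piComm fun (_ : Fin K) (_ : Fin V) => ℕ) y v k = m k then
          ∫ θ in Set.univ.pi fun _ : Fin K => Set.Ioi (0 : ℝ),
            (∏ v, ∏ k, poisPMF (φ v k * θ k * s)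
              ((Equiv.piComm fun (_ : Fin K) (_ : Fin V) => ℕ) y v k))
              * ∏ k, gammaPDF (a k) c (θ k)
        else 0)
        = ∏ k, (Nat.multinomial Finset.univ (y k) * (∏ v, φ v k ^ y k v))
            * nbPMF (a k) (s / (c + s)) (m k) := by
      intro y hy
      have hsum : ∀ k, ∑ v, y k v = m k := fun k =>
        (Finset.mem_piAntidiag.1 (Fintype.mem_piFinset.1 hy k)).1
      simp only [Equiv.piComm_apply, Function.swap]
      rw [if_pos hsum, volume_pi, Measure.restrict_pi_pi]
      simp_rw [Finset.prod_comm (s := (Finset.univ : Finset (Fin V))), ← Finset.prod_mul_distrib]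
      rw [integral_fintype_prod_eq_prod (𝕜 := ℝ) (fun k θ =>
        (∏ v, poisPMF (φ v k * θ * s) (y k v)) * gammaPDF (a k) c θ)]
      exact Finset.prod_congr rfl fun k _ => integral_prod_poisPMF_mul_gammaPDF
        (fun v => φ v k) (hφsum k) (ha k) hc hs (y k) (m k) (hsum k)
    rw [Finset.sum_congr rfl hterm, ← Finset.prod_univ_sum _ fun k z =>
      (Nat.multinomial Finset.univ z * ∏ v, φ v k ^ z v) * nbPMF (a k) (s / (c + s)) (m k)]
    refine Finset.prod_congr rfl fun k _ => ?_
    rw [← Finset.sum_mul, ← Finset.sum_pow_eq_sum_piAntidiag, hφsum, one_pow, one_mul]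
  · intro y hy
    refine if_neg fun h => hy ?_
    simpa [Fintype.mem_piFinset] using h
end
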